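/- The left annihilators lann(x^n) = {r ∈ R : r x^n = 0} form a strictly ascending chain of left ideals of R: lann(x) ⊊ lann(x²) ⊊ lann(x³) ⊊ ⋯. In particular, R does not satisfy the ascending chain condition on left annihilator ideals. -/

import Mathlib

/-!
`R = k⟨x,y⟩/⟨yx − 1⟩` is the associative `k`-algebra generated by `x` and `y`
with the single defining relation `y * x = 1` (the one-sided inverse of `k[x]`).
We realize it as the `RingQuot` of the free algebra on two generators.
-/

noncomputable section

/-- The defining relation `y * x = 1` on the free algebra `k⟨x,y⟩`. -/
inductive PreRel (k : Type) [Field k] : FreeAlgebra k (Fin 2) → FreeAlgebra k (Fin 2) → Prop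
  | yx : PreRel k (FreeAlgebra.ι k 1 * FreeAlgebra.ι k 0) 1

/-- `R = k⟨x,y⟩/⟨yx − 1⟩`. -/
abbrev R (k : Type) [Field k] := RingQuot (PreRel k)

/-- The generator `x` of `R`. -/
def Xg (k : Type) [Field k] : R k := RingQuot.mkAlgHom k (PreRel k) (FreeAlgebra.ι k 0)

/-- The generator `y` of `R`. -/
def Yg (k : Type) [Field k] : R k := RingQuot.mkAlgHom k (PreRel k) (FreeAlgebra.ι k 1)

/-- The left annihilator `lann(a) = {r ∈ R : r * a = 0}`, a left ideal of `R`. -/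
def lann (k : Type) [Field k] (a : R k) : Ideal (R k) :=
  LinearMap.ker (LinearMap.toSpanSingleton (R k) (R k) a)

theorem Yg_mul_Xg (k : Type) [Field k] : Yg k * Xg k = 1 := by
  unfold Yg Xg
  rw [← map_mul, RingQuot.mkAlgHom_rel k (PreRel.yx (k := k)), map_one]

/-- right shift on sequences -/
def shiftX (k : Type) [Field k] : Module.End k (ℕ → k) where
  toFun f := fun n => if n = 0 then 0 else f (n - 1)
  map_add' f g := by
    funext n
    by_cases h : n = 0 <;> simp [h]
  map_smul' c f := by
    funext n
    by_cases h : n = 0 <;> simp [h]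

/-- left shift on sequences -/
def shiftY (k : Type) [Field k] : Module.End k (ℕ → k) where
  toFun f := fun n => f (n + 1)
  map_add' f g := rfl
  map_smul' c f := rfl

theorem shiftY_mul_shiftX (k : Type) [Field k] : shiftY k * shiftX k = 1 := by
  ext f n
  simp [shiftY, shiftX]

/-- the representation of `R` by shifts -/
def shiftRep (k : Type) [Field k] : R k →ₐ[k] Module.End k (ℕ → k) :=
  RingQuot.liftAlgHom k ⟨FreeAlgebra.lift k ![shiftX k, shiftY k], by
    intro a b h
    cases h
    simp [shiftY_mul_shiftX]⟩

theorem Xg_mul_Yg_ne (k : Type) [Field k] : 1 - Xg k * Yg k ≠ 0 := by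
  intro h
  have h2 := congrArg (shiftRep k) h
  have hX : shiftRep k (Xg k) = shiftX k := by
    simp [shiftRep, Xg]
  have hY : shiftRep k (Yg k) = shiftY k := by
    simp [shiftRep, Yg]
  rw [map_sub, map_mul, map_one, map_zero, hX, hY] at h2
  have h3 := congrFun (LinearMap.congr_fun h2 (fun _ => (1 : k))) 0
  simp [shiftX] at h3

theorem Yg_pow_mul_Xg_pow (k : Type) [Field k] (n : ℕ) : Yg k ^ n * Xg k ^ n = 1 := by
  induction n with
  | zero => simp
  | succ n ih =>
    rw [pow_succ, pow_succ', mul_assoc, ← mul_assoc (Yg k) (Xg k), Yg_mul_Xg, one_mul, ih]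

theorem mem_lann (k : Type) [Field k] (a r : R k) : r ∈ lann k a ↔ r * a = 0 := by
  simp [lann]

theorem lann_lt (k : Type) [Field k] (n : ℕ) :
    lann k (Xg k ^ n) < lann k (Xg k ^ (n + 1)) := by
  refine lt_of_le_not_ge ?_ ?_
  · intro r hr
    rw [mem_lann] at hr ⊢
    rw [pow_succ, ← mul_assoc, hr, zero_mul]
  · intro h
    have h1 : (1 - Xg k * Yg k) * Yg k ^ n ∈ lann k (Xg k ^ (n + 1)) := by
      rw [mem_lann, pow_succ, mul_assoc, ← mul_assoc (Yg k ^ n), Yg_pow_mul_Xg_pow, one_mul,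
        sub_mul, mul_assoc, Yg_mul_Xg, one_mul, mul_one, sub_self]
    have h2 := h h1
    rw [mem_lann, mul_assoc, Yg_pow_mul_Xg_pow, mul_one] at h2
    exact Xg_mul_Yg_ne k h2

/-- the left annihilators `lann(x^n)` form a strictly ascending chain
`lann(x) ⊊ lann(x²) ⊊ ⋯` of left ideals; in particular `R` does not satisfy the
ascending chain condition on left annihilator ideals. -/
theorem lann_chain_strictMono (k : Type) [Field k] :
    (∀ n : ℕ, 1 ≤ n → lann k (Xg k ^ n) < lann k (Xg k ^ (n + 1))) ∧
    ¬ (∀ c : ℕ → Ideal (R k), Monotone c → (∀ n : ℕ, ∃ a : R k, c n = lann k a) →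
        ∃ n : ℕ, ∀ m : ℕ, n ≤ m → c m = c n) := by
  refine ⟨fun n _ => lann_lt k n, fun h => ?_⟩
  obtain ⟨n, hn⟩ := h (fun n => lann k (Xg k ^ n))
    (monotone_nat_of_le_succ fun n => (lann_lt k n).le) (fun n => ⟨_, rfl⟩)
  exact (lann_lt k n).ne' (hn (n + 1) (Nat.le_succ n))
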